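/- (q-Pfaff–Saalschütz sum) Let n be a nonnegative integer and let q, a, b, c be nonzero complex numbers such that (q;q)_n ≠ 0, (c;q)_n ≠ 0, (a b q^{-n+1}/c;q)_n ≠ 0, and (c/(ab);q)_n ≠ 0. Then ∑_{j=0}^{n} ((a;q)_j (b;q)_j (q^{-n};q)_j / ((q;q)_j (c;q)_j (a b q^{-n+1}/c;q)_j)) · q^j = (c/a;q)_n (c/b;q)_n / ((c;q)_n (c/(ab);q)_n). -/

import Mathlib

/-- The $q$-shifted factorial $(a;q)_m = \prod_{k=0}^{m-1}(1 - a q^k)$. -/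
noncomputable def qPoch (q a : ℂ) (m : ℕ) : ℂ := ∏ k ∈ Finset.range m, (1 - a * q ^ k)

theorem qPoch_zero (q a : ℂ) : qPoch q a 0 = 1 := by simp [qPoch]

theorem qPoch_succ (q a : ℂ) (m : ℕ) : qPoch q a (m + 1) = qPoch q a m * (1 - a * q ^ m) :=
  Finset.prod_range_succ _ _

theorem qPoch_succ' (q a : ℂ) (m : ℕ) : qPoch q a (m + 1) = (1 - a) * qPoch q (a * q) m := by
  simp only [qPoch, Finset.prod_range_succ', pow_zero, mul_one]
  rw [mul_comm]
  congr 1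
  exact Finset.prod_congr rfl fun k _ => by ring

theorem qPoch_ne_zero_iff (q a : ℂ) (m : ℕ) :
    qPoch q a m ≠ 0 ↔ ∀ k < m, 1 - a * q ^ k ≠ 0 := by
  simp [qPoch, Finset.prod_ne_zero_iff]

/-- The summand of the balanced `₃φ₂` series with `w = q ^ (-n)` and `x = a * b / c`. -/
noncomputable def saalschutzTerm (q a b c w x : ℂ) (j : ℕ) : ℂ :=
  qPoch q a j * qPoch q b j * qPoch q w j / (qPoch q q j * qPoch q c j * qPoch q (x * w * q) j)

theorem saalschutzTerm_zero (q a b c w x : ℂ) : saalschutzTerm q a b c w x 0 = 1 := by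
  simp [saalschutzTerm, qPoch_zero]

theorem saalschutzTerm_succ (q a b c w x : ℂ) (j : ℕ) :
    saalschutzTerm q a b c w x (j + 1) = saalschutzTerm q a b c w x j *
      ((1 - a * q ^ j) * (1 - b * q ^ j) * (1 - w * q ^ j) /
        ((1 - q * q ^ j) * (1 - c * q ^ j) * (1 - x * w * q * q ^ j))) := by
  simp only [saalschutzTerm, qPoch_succ, div_mul_div_comm]
  congr 1 <;> ring

theorem saalschutzTerm_div_succ {q : ℂ} (hq : q ≠ 0) (a b c w x : ℂ) (j : ℕ) :
    saalschutzTerm q a b c (w / q) x (j + 1) = saalschutzTerm q a b c w x j *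
      ((1 - a * q ^ j) * (1 - b * q ^ j) * (1 - w / q) /
        ((1 - q * q ^ j) * (1 - c * q ^ j) * (1 - x * w))) := by
  have h : x * (w / q) * q = x * w := by field_simp
  simp only [saalschutzTerm, h, div_mul_div_comm]
  rw [qPoch_succ' q (w / q), qPoch_succ' q (x * w), div_mul_cancel₀ _ hq]
  simp only [qPoch_succ]
  congr 1 <;> ring

theorem saalschutz_telescope {q a b c w : ℂ} (hq : q ≠ 0) (ha : a ≠ 0) (hb : b ≠ 0) (hc : c ≠ 0)
    (hw : w ≠ 0) (hx : 1 - a * b / c * w ≠ 0) (m : ℕ)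
    (h1 : ∀ k < m, 1 - q * q ^ k ≠ 0) (h2 : ∀ k < m, 1 - c * q ^ k ≠ 0)
    (h3 : ∀ k < m, 1 - a * b / c * w * q * q ^ k ≠ 0) :
    (1 - c / w) * (1 - c / (a * b * w)) *
        ∑ j ∈ Finset.range (m + 1), saalschutzTerm q a b c (w / q) (a * b / c) j * q ^ j -
      (1 - c / (a * w)) * (1 - c / (b * w)) *
        ∑ j ∈ Finset.range (m + 1), saalschutzTerm q a b c w (a * b / c) j * q ^ j =
      -(c / (a * b * w)) * saalschutzTerm q a b c w (a * b / c) m *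
        ((1 - a * q ^ m) * (1 - b * q ^ m)) := by
  induction m with
  | zero =>
    simp only [zero_add, Finset.sum_range_one, saalschutzTerm_zero, pow_zero]
    field_simp
    ring
  | succ m ih =>
    have ih := ih (fun k hk => h1 k (by omega)) (fun k hk => h2 k (by omega))
      (fun k hk => h3 k (by omega))
    have h1 := h1 m (by omega)
    have h2 := h2 m (by omega)
    have h3 := h3 m (by omega)
    rw [Finset.sum_range_succ, Finset.sum_range_succ _ (m + 1), mul_add, mul_add,
      add_sub_add_comm, ih, saalschutzTerm_div_succ hq, saalschutzTerm_succ, pow_succ]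
    generalize saalschutzTerm q a b c w (a * b / c) m = P
    generalize q ^ m = z at *
    have hx' : c - a * b * w ≠ 0 := fun h => hx (by field_simp; linear_combination h)
    have h3' : c - a * b * w * q * z ≠ 0 := fun h => h3 (by field_simp; linear_combination h)
    have e1 : 1 - a * b / c * w = (c - a * b * w) / c := by field_simp
    have e3 : 1 - a * b / c * w * q * z = (c - a * b * w * q * z) / c := by field_simp
    rw [e1, e3]
    generalize hu : 1 - q * z = u at *
    generalize hv : c - a * b * w = v at *
    generalize ht : c - a * b * w * q * z = t at *
    generalize hs : 1 - c * z = s at *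
    field_simp
    subst hu hv ht hs
    ring

theorem saalschutz_sum {q a b c : ℂ} (hq : q ≠ 0) (ha : a ≠ 0) (hb : b ≠ 0) (hc : c ≠ 0) (n : ℕ)
    (h1 : ∀ k < n, 1 - q * q ^ k ≠ 0) (h2 : ∀ k < n, 1 - c * q ^ k ≠ 0)
    (h4 : ∀ k < n, 1 - c / (a * b) * q ^ k ≠ 0) :
    ∑ j ∈ Finset.range (n + 1), saalschutzTerm q a b c (q ^ n)⁻¹ (a * b / c) j * q ^ j =
      qPoch q (c / a) n * qPoch q (c / b) n / (qPoch q c n * qPoch q (c / (a * b)) n) := by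
  induction n with
  | zero => simp [saalschutzTerm_zero, qPoch_zero]
  | succ n ih =>
    have ih := ih (fun k hk => h1 k (by omega)) (fun k hk => h2 k (by omega))
      (fun k hk => h4 k (by omega))
    have key : ∀ k ≤ n, 1 - a * b / c * (q ^ n)⁻¹ * q ^ k ≠ 0 := fun k hk h => by
      refine h4 (n - k) (by omega) ?_
      have e : q ^ n = q ^ (n - k) * q ^ k := by rw [← pow_add]; congr 1; omega
      rw [e] at h
      field_simp at h ⊢
      linear_combination -h
    have tel := saalschutz_telescope (w := (q ^ n)⁻¹) hq ha hb hc (by positivity)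
      (by simpa using key 0 (by omega)) n (fun k hk => h1 k (by omega))
      (fun k hk => h2 k (by omega)) (fun k hk => by
        have := key (k + 1) (by omega)
        rwa [pow_succ', ← mul_assoc] at this)
    have hx := key 0 (by omega)
    have hw : (q ^ (n + 1))⁻¹ = (q ^ n)⁻¹ / q := by rw [pow_succ]; field_simp
    have d1 := h1 n (by omega)
    have d2 := h2 n (by omega)
    have d4 := h4 n (by omega)
    rw [ih] at tel
    rw [Finset.sum_range_succ, hw, saalschutzTerm_div_succ hq]
    simp only [qPoch_succ]
    have p2 := (qPoch_ne_zero_iff q c n).2 fun k hk => h2 k (by omega)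
    have p4 := (qPoch_ne_zero_iff q (c / (a * b)) n).2 fun k hk => h4 k (by omega)
    generalize saalschutzTerm q a b c (q ^ n)⁻¹ (a * b / c) n = P at *
    generalize qPoch q c n = C at *
    generalize qPoch q (c / (a * b)) n = E at *
    generalize qPoch q (c / a) n = A at *
    generalize qPoch q (c / b) n = B at *
    have hz : q ^ n ≠ 0 := pow_ne_zero _ hq
    rw [pow_succ]
    generalize q ^ n = z at *
    have top : (1 - c * z) * (1 - c / (a * b) * z) * (P * ((1 - a * z) * (1 - b * z) *
        (1 - z⁻¹ / q) / ((1 - q * z) * (1 - c * z) * (1 - a * b / c * z⁻¹))) * (z * q)) =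
        c / (a * b) * z * P * ((1 - a * z) * (1 - b * z)) := by
      have hx' : c * z - a * b ≠ 0 := fun h => hx (by field_simp; linear_combination h)
      have e1 : 1 - a * b / c * z⁻¹ = (c * z - a * b) / (c * z) := by field_simp
      have e2 : 1 - z⁻¹ / q = -(1 - q * z) / (z * q) := by field_simp; ring
      rw [e1, e2]
      generalize hu : 1 - q * z = u at *
      field_simp
      ring
    apply mul_left_cancel₀ (mul_ne_zero d2 d4)
    rw [mul_add, top]
    have rhs : (1 - c * z) * (1 - c / (a * b) * z) * (A * (1 - c / a * z) * (B * (1 - c / b * z)) /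
        (C * (1 - c * z) * (E * (1 - c / (a * b) * z)))) =
        (1 - c / a * z) * (1 - c / b * z) * (A * B / (C * E)) := by
      generalize 1 - c / (a * b) * z = d at *
      field_simp
    rw [rhs]
    have r : ∀ t : ℂ, c / (t * z⁻¹) = c / t * z := fun t => by
      rw [← div_div, div_inv_eq_mul]
    rw [r, r, r, div_inv_eq_mul] at tel
    linear_combination tel

/-- $q$-Pfaff–Saalschütz sum. -/
theorem q_pfaff_saalschutz (n : ℕ) (q a b c : ℂ)
    (hq : q ≠ 0) (ha : a ≠ 0) (hb : b ≠ 0) (hc : c ≠ 0)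
    (h1 : qPoch q q n ≠ 0) (h2 : qPoch q c n ≠ 0)
    (h3 : qPoch q (a * b * q ^ (1 - (n : ℤ)) / c) n ≠ 0)
    (h4 : qPoch q (c / (a * b)) n ≠ 0) :
    ∑ j ∈ Finset.range (n + 1),
      qPoch q a j * qPoch q b j * qPoch q (q ^ (-(n : ℤ))) j /
        (qPoch q q j * qPoch q c j * qPoch q (a * b * q ^ (1 - (n : ℤ)) / c) j) * q ^ j
    = qPoch q (c / a) n * qPoch q (c / b) n / (qPoch q c n * qPoch q (c / (a * b)) n) := by
  have e : a * b * q ^ (1 - (n : ℤ)) / c = a * b / c * (q ^ n)⁻¹ * q := by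
    rw [zpow_sub₀ hq, zpow_one, zpow_natCast]
    ring
  rw [e, zpow_neg, zpow_natCast]
  exact saalschutz_sum hq ha hb hc n ((qPoch_ne_zero_iff q q n).1 h1)
    ((qPoch_ne_zero_iff q c n).1 h2) ((qPoch_ne_zero_iff q (c / (a * b)) n).1 h4)
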